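/- For any integer p ≥ 1 there is a constant c = c(p) ∈ [1/2, 1] maximizing the function f(x) = x(1-x)^p + x^p(1-x) on [0,1] such that: for every ε > 0 there exists N so that for all n ≥ N, if G is a simple graph on n vertices containing no cycle of length 5 as a subgraph, and G maximizes e_p among all C5-free simple graphs on n vertices (i.e., e_p(G) ≥ e_p(G') for every C5-free simple graph G' on n vertices), then G is a complete bipartite graph whose two vertex classes have sizes m and n - m with |m - c·n| ≤ ε·n. -/

import Mathlib

/-- A graph is `C5`-free if it contains no cycle of length 5 as a subgraph,
i.e. no five distinct vertices that are consecutively adjacent in cyclic order. -/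
def C5Free {V : Type*} (G : SimpleGraph V) : Prop :=
  ¬ ∃ v : Fin 5 → V, Function.Injective v ∧ ∀ i : Fin 5, G.Adj (v i) (v (i + 1))

/-- The sum of the `p`-th powers of the degrees of a finite graph. -/
noncomputable def ep {V : Type*} [Fintype V] (G : SimpleGraph V) (p : ℕ) : ℕ :=
  letI : DecidableRel G.Adj := fun _ _ => Classical.dec _
  ∑ v, G.degree v ^ p

open Classical in
/-- number of neighbours of `u` in `S` -/
noncomputable def dg {V : Type*} (G : SimpleGraph V) (u : V) (S : Finset V) : ℕ :=
  (S.filter (fun w => G.Adj u w)).card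

open Classical in
/-- number of non-neighbours of `u` in `S` -/
noncomputable def ms {V : Type*} (G : SimpleGraph V) (u : V) (S : Finset V) : ℕ :=
  (S.filter (fun w => ¬ G.Adj u w)).card

/-- the complete bipartite graph with parts `s`, `sᶜ` -/
def bip {V : Type*} (s : Finset V) : SimpleGraph V where
  Adj a b := (a ∈ s ∧ b ∉ s) ∨ (a ∉ s ∧ b ∈ s)
  symm := ⟨by intro a b h; tauto⟩
  loopless := ⟨by intro a h; tauto⟩

theorem dg_add_ms {V : Type*} (G : SimpleGraph V) (u : V) (S : Finset V) :
    dg G u S + ms G u S = S.card := by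
  classical
  unfold dg ms
  exact Finset.card_filter_add_card_filter_not (s := S) (fun w => G.Adj u w)

theorem dg_mono {V : Type*} (G : SimpleGraph V) (u : V) {S T : Finset V} (h : S ⊆ T) :
    dg G u S ≤ dg G u T := by
  classical
  unfold dg
  exact Finset.card_le_card (Finset.filter_subset_filter _ h)

theorem dg_le_card {V : Type*} (G : SimpleGraph V) (u : V) (S : Finset V) :
    dg G u S ≤ S.card := by
  classical
  exact Finset.card_filter_le _ _

theorem ep_eq {V : Type*} [Fintype V] (G : SimpleGraph V) (p : ℕ) :
    ep G p = ∑ v, dg G v Finset.univ ^ p := by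
  classical
  unfold ep dg
  refine Finset.sum_congr rfl fun v _ => ?_
  congr 1
  rw [← SimpleGraph.card_neighborFinset_eq_degree, SimpleGraph.neighborFinset_eq_filter]

theorem dg_univ_split {V : Type*} [Fintype V] [DecidableEq V] (G : SimpleGraph V) (u : V)
    (S : Finset V) : dg G u Finset.univ = dg G u S + dg G u Sᶜ := by
  classical
  unfold dg
  rw [← Finset.card_union_of_disjoint, ← Finset.filter_union, Finset.union_compl]
  exact Finset.disjoint_filter_filter disjoint_compl_right

theorem c5_elim {V : Type*} {G : SimpleGraph V} (hG : C5Free G) {a b c d e : V}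
    (h1 : G.Adj a b) (h2 : G.Adj b c) (h3 : G.Adj c d) (h4 : G.Adj d e) (h5 : G.Adj e a)
    (n1 : a ≠ c) (n2 : a ≠ d) (n3 : b ≠ d) (n4 : b ≠ e) (n5 : c ≠ e) : False := by
  apply hG
  refine ⟨![a, b, c, d, e], ?_, ?_⟩
  · have := h1.ne
    have := h2.ne
    have := h3.ne
    have := h4.ne
    have := h5.ne
    intro i j hij
    fin_cases i <;> fin_cases j <;> simp_all
  · intro i
    fin_cases i
    · exact h1
    · exact h2
    · exact h3
    · exact h4
    · exact h5

theorem bip_c5 {V : Type*} (s : Finset V) : C5Free (bip s) := by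
  rintro ⟨v, -, h⟩
  have h0 := h 0
  have h1 := h 1
  have h2 := h 2
  have h3 := h 3
  have h4 := h 4
  simp only [bip] at h0 h1 h2 h3 h4
  have e0 : (0 : Fin 5) + 1 = 1 := rfl
  have e1 : (1 : Fin 5) + 1 = 2 := rfl
  have e2 : (2 : Fin 5) + 1 = 3 := rfl
  have e3 : (3 : Fin 5) + 1 = 4 := rfl
  have e4 : (4 : Fin 5) + 1 = 0 := rfl
  rw [e0] at h0; rw [e1] at h1; rw [e2] at h2; rw [e3] at h3; rw [e4] at h4
  tauto

theorem dg_bip_mem {V : Type*} [Fintype V] [DecidableEq V] (s : Finset V) {u : V} (hu : u ∈ s) :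
    dg (bip s) u Finset.univ = sᶜ.card := by
  unfold dg
  congr 1
  ext w
  simp [bip, hu]

theorem dg_bip_not_mem {V : Type*} [Fintype V] [DecidableEq V] (s : Finset V) {u : V}
    (hu : u ∉ s) : dg (bip s) u Finset.univ = s.card := by
  unfold dg
  congr 1
  ext w
  simp [bip, hu]

theorem ep_bip {V : Type*} [Fintype V] [DecidableEq V] (s : Finset V) (p : ℕ) :
    ep (bip s) p = s.card * sᶜ.card ^ p + sᶜ.card * s.card ^ p := by
  rw [ep_eq, ← Finset.sum_add_sum_compl s]
  congr 1
  · rw [Finset.sum_congr rfl (fun u hu => by rw [dg_bip_mem s hu])]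
    simp
  · rw [Finset.sum_congr rfl (fun u hu => by rw [dg_bip_not_mem s (Finset.mem_compl.1 hu)])]
    simp

theorem pow_add_bound (x t p : ℕ) : (x + t) ^ (p + 1) ≤ x ^ (p + 1) + (p + 1) * t * (x + t) ^ p := by
  induction p with
  | zero => simp
  | succ p ih =>
    have h1 : x * (x + t) ^ p ≤ (x + t) ^ (p + 1) := by
      rw [pow_succ' (x + t)]
      exact Nat.mul_le_mul_right _ (by omega)
    calc (x + t) ^ (p + 1 + 1) = x * (x + t) ^ (p + 1) + t * (x + t) ^ (p + 1) := by ring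
      _ ≤ x * (x ^ (p + 1) + (p + 1) * t * (x + t) ^ p) + t * (x + t) ^ (p + 1) := by gcongr
      _ = x ^ (p + 1 + 1) + (p + 1) * t * (x * (x + t) ^ p) + t * (x + t) ^ (p + 1) := by ring
      _ ≤ x ^ (p + 1 + 1) + (p + 1) * t * ((x + t) ^ (p + 1)) + t * (x + t) ^ (p + 1) := by gcongr
      _ = _ := by ring

theorem pow_sub_bound (x t p : ℕ) : x ^ (p + 1) + t * (x + t) ^ p ≤ (x + t) ^ (p + 1) := by
  have : x ^ p ≤ (x + t) ^ p := Nat.pow_le_pow_left (by omega) _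
  calc x ^ (p + 1) + t * (x + t) ^ p = x * x ^ p + t * (x + t) ^ p := by ring
    _ ≤ x * (x + t) ^ p + t * (x + t) ^ p := by gcongr
    _ = _ := by ring

theorem exists_ne_of_card {V : Type*} (S : Finset V) (F : Finset V) (h : F.card < S.card) :
    ∃ x ∈ S, x ∉ F := Finset.exists_mem_notMem_of_card_lt_card h

/-- neighbourhoods contain few edges -/
theorem nbhd_sum {V : Type*} {G : SimpleGraph V} (hG : C5Free G) (v : V)
    (A : Finset V) (hA : ∀ u ∈ A, G.Adj v u) :
    ∑ u ∈ A, dg G u A ≤ 4 * A.card := by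
  classical
  have key : ∀ x ∈ A, ∀ y ∈ A, G.Adj x y → dg G x A ≤ 2 ∨ dg G y A ≤ 2 := by
    intro x hx y hy hxy
    by_contra! hcon
    obtain ⟨hx3, hy3⟩ := hcon
    obtain ⟨x', hx', hx'F⟩ := exists_ne_of_card (A.filter (fun w => G.Adj x w)) {y}
      (by simp only [Finset.card_singleton]; unfold dg at hx3; omega)
    obtain ⟨y', hy', hy'F⟩ := exists_ne_of_card (A.filter (fun w => G.Adj y w)) {x, x'}
      (by have := Finset.card_le_two (a := x) (b := x'); unfold dg at hy3; omega)
    simp only [Finset.mem_filter, Finset.mem_singleton, Finset.mem_insert, not_or] at *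
    exact c5_elim hG (hA x' hx'.1) hx'.2.symm hxy hy'.2 (hA y' hy'.1).symm (hA x hx).ne
      (hA y hy).ne hx'F (Ne.symm hy'F.2) (Ne.symm hy'F.1)
  have h1 : ∑ u ∈ A, dg G u A = ∑ u ∈ A, ∑ w ∈ A, if G.Adj u w then 1 else 0 := by
    refine Finset.sum_congr rfl fun u _ => ?_
    unfold dg
    rw [Finset.card_filter]
  have h2 : ∑ u ∈ A, ∑ w ∈ A, (if G.Adj u w then 1 else 0) ≤
      ∑ u ∈ A, ∑ w ∈ A, ((if G.Adj u w then (if dg G u A ≤ 2 then 1 else 0) else 0) +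
        (if G.Adj w u then (if dg G w A ≤ 2 then 1 else 0) else 0)) := by
    refine Finset.sum_le_sum fun u hu => Finset.sum_le_sum fun w hw => ?_
    by_cases h : G.Adj u w
    · have := key u hu w hw h
      simp only [h, h.symm, if_true]
      rcases this with h | h <;> simp [h]
    · simp [h]
  have h3 : ∑ u ∈ A, ∑ w ∈ A, (if G.Adj u w then (if dg G u A ≤ 2 then 1 else 0) else 0) ≤
      2 * A.card := by
    rw [mul_comm, ← smul_eq_mul, ← Finset.sum_const]
    refine Finset.sum_le_sum fun u _ => ?_
    rw [← Finset.sum_filter, Finset.sum_const, smul_eq_mul]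
    change dg G u A * _ ≤ 2
    split_ifs with h <;> simp [h]
  have h4 : ∑ u ∈ A, ∑ w ∈ A, (if G.Adj w u then (if dg G w A ≤ 2 then 1 else 0) else 0) ≤
      2 * A.card := by
    rw [Finset.sum_comm]; exact h3
  rw [h1]
  simp only [Finset.sum_add_distrib] at h2
  omega

/-- a set of half size -/
theorem ep_lower {V : Type*} [Fintype V] [DecidableEq V] (G : SimpleGraph V) (p : ℕ)
    (hmax : ∀ G' : SimpleGraph V, C5Free G' → ep G' p ≤ ep G p) :
    Fintype.card V * (Fintype.card V / 2) ^ p ≤ ep G p := by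
  obtain ⟨s, -, hs⟩ := Finset.exists_subset_card_eq (s := (Finset.univ : Finset V))
    (n := Fintype.card V / 2) (by rw [Finset.card_univ]; omega)
  refine le_trans ?_ (hmax (bip s) (bip_c5 s))
  rw [ep_bip]
  have h := Finset.card_add_card_compl s
  have h1 : Fintype.card V / 2 ≤ sᶜ.card := by omega
  have h2 : Fintype.card V / 2 ≤ s.card := by omega
  calc Fintype.card V * (Fintype.card V / 2) ^ p
      = s.card * (Fintype.card V / 2) ^ p + sᶜ.card * (Fintype.card V / 2) ^ p := by
        rw [← add_mul, h]
    _ ≤ _ := by gcongr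

theorem stab {q : ℕ} {V : Type*} [Fintype V] [DecidableEq V] {G : SimpleGraph V} (hG : C5Free G)
    (hmax : ∀ G' : SimpleGraph V, C5Free G' → ep G' (q + 1) ≤ ep G (q + 1))
    (hn : 3 ^ (q + 1) * (8 * (q + 1)) ≤ Fintype.card V) :
    ∃ A : Finset V, Fintype.card V ≤ 4 * 3 ^ (q + 1) * A.card ∧
      Fintype.card V ≤ 4 * 3 ^ (q + 1) * Aᶜ.card ∧
      ∑ u ∈ A, ms G u Aᶜ ≤ 4 * (q + 1) * (4 * 3 ^ (q + 1)) ^ q * Fintype.card V := by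
  classical
  set n := Fintype.card V with hndef
  have h3pos : 0 < 3 ^ (q + 1) := by positivity
  have hn8 : 8 ≤ n := by
    refine le_trans ?_ hn
    nlinarith
  have : Nonempty V := Fintype.card_pos_iff.1 (by omega)
  obtain ⟨v, -, hv⟩ := Finset.exists_max_image (Finset.univ : Finset V)
    (fun u => dg G u Finset.univ) Finset.univ_nonempty
  set A : Finset V := Finset.univ.filter (fun w => G.Adj v w) with hA
  have hAcard : dg G v Finset.univ = A.card := by
    unfold dg
    rfl
  simp only [hAcard, Finset.mem_univ, true_implies] at hv
  set a := A.card with ha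
  set b := Aᶜ.card with hb
  have hab : a + b = n := Finset.card_add_card_compl A
  have ht : ∑ u ∈ A, dg G u A ≤ 4 * a := nbhd_sum hG v A (by simp [hA])
  have hep : ep G (q + 1) = ∑ u ∈ A, dg G u Finset.univ ^ (q + 1) +
      ∑ u ∈ Aᶜ, dg G u Finset.univ ^ (q + 1) := by
    rw [ep_eq, Finset.sum_add_sum_compl]
  have hB : ∑ u ∈ Aᶜ, dg G u Finset.univ ^ (q + 1) ≤ b * a ^ (q + 1) := by
    rw [← smul_eq_mul, ← Finset.sum_const]
    exact Finset.sum_le_sum fun u _ => Nat.pow_le_pow_left (hv u) _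
  have hAA : ∑ u ∈ A, dg G u Finset.univ ^ (q + 1) ≤
      ∑ u ∈ A, dg G u Aᶜ ^ (q + 1) + 4 * (q + 1) * n ^ (q + 1) := by
    calc ∑ u ∈ A, dg G u Finset.univ ^ (q + 1)
        ≤ ∑ u ∈ A, (dg G u Aᶜ ^ (q + 1) + (q + 1) * n ^ q * dg G u A) := by
          refine Finset.sum_le_sum fun u _ => ?_
          have e : dg G u Finset.univ = dg G u Aᶜ + dg G u A := by
            rw [dg_univ_split G u A, add_comm]
          have e2 : dg G u Aᶜ + dg G u A ≤ n := by
            rw [← e]; exact dg_le_card _ _ _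
          rw [e]
          refine (pow_add_bound _ _ _).trans ?_
          have := Nat.pow_le_pow_left e2 q
          calc _ ≤ dg G u Aᶜ ^ (q + 1) + (q + 1) * dg G u A * n ^ q := by gcongr
            _ = _ := by ring
      _ = ∑ u ∈ A, dg G u Aᶜ ^ (q + 1) + (q + 1) * n ^ q * ∑ u ∈ A, dg G u A := by
          rw [Finset.sum_add_distrib, Finset.mul_sum]
      _ ≤ ∑ u ∈ A, dg G u Aᶜ ^ (q + 1) + (q + 1) * n ^ q * (4 * n) := by
          have : 4 * a ≤ 4 * n := by omega
          gcongr
          omega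
      _ = _ := by ring
  have hlow := ep_lower G (q + 1) hmax
  rw [← hndef] at hlow
  -- a is large
  have ha3 : n ≤ 3 * a := by
    have h1 : ep G (q + 1) ≤ n * a ^ (q + 1) := by
      rw [ep_eq, hndef, ← Finset.card_univ, ← smul_eq_mul, ← Finset.sum_const]
      exact Finset.sum_le_sum fun u _ => Nat.pow_le_pow_left (hv u) _
    have h2 : (n / 2) ^ (q + 1) ≤ a ^ (q + 1) :=
      Nat.le_of_mul_le_mul_left (hlow.trans h1) (by omega)
    have h3 : n / 2 ≤ a := (Nat.pow_le_pow_iff_left (by omega)).1 h2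
    omega
  have hBA : ∀ u, dg G u Aᶜ ≤ b := fun u => dg_le_card _ _ _
  have hb3 : n ≤ 4 * 3 ^ (q + 1) * b := by
    have h1 : ∑ u ∈ A, dg G u Aᶜ ^ (q + 1) ≤ a * b ^ (q + 1) := by
      rw [ha, ← smul_eq_mul, ← Finset.sum_const]
      exact Finset.sum_le_sum fun u _ => Nat.pow_le_pow_left (hBA u) _
    have h2 : a * b ^ (q + 1) ≤ b * n ^ (q + 1) := by
      have : b ^ q ≤ n ^ q := Nat.pow_le_pow_left (by omega) _
      calc a * b ^ (q + 1) = b * (a * b ^ q) := by ring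
        _ ≤ b * (n * n ^ q) := by gcongr; omega
        _ = _ := by ring
    have h3 : b * a ^ (q + 1) ≤ b * n ^ (q + 1) := by
      gcongr; omega
    have h4 : n * (n / 2) ^ (q + 1) ≤ (2 * b + 4 * (q + 1)) * n ^ (q + 1) := by
      have : (2 * b + 4 * (q + 1)) * n ^ (q + 1) =
        b * n ^ (q + 1) + b * n ^ (q + 1) + 4 * (q + 1) * n ^ (q + 1) := by ring
      omega
    have h5 : n ^ (q + 1) ≤ 3 ^ (q + 1) * (n / 2) ^ (q + 1) := by
      rw [← mul_pow]
      exact Nat.pow_le_pow_left (by omega) _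
    have h6 : n * n ^ (q + 1) ≤ (3 ^ (q + 1) * (2 * b + 4 * (q + 1))) * n ^ (q + 1) := by
      calc n * n ^ (q + 1) ≤ n * (3 ^ (q + 1) * (n / 2) ^ (q + 1)) := by gcongr
        _ = 3 ^ (q + 1) * (n * (n / 2) ^ (q + 1)) := by ring
        _ ≤ 3 ^ (q + 1) * ((2 * b + 4 * (q + 1)) * n ^ (q + 1)) := by gcongr
        _ = _ := by ring
    have h7 : n ≤ 3 ^ (q + 1) * (2 * b + 4 * (q + 1)) :=
      Nat.le_of_mul_le_mul_right h6 (by positivity)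
    nlinarith
  have ha4 : n ≤ 4 * 3 ^ (q + 1) * a := by nlinarith
  refine ⟨A, ha4, hb3, ?_⟩
  have hbpos : 0 < b := by
    rcases Nat.eq_zero_or_pos b with h | h
    · rw [h] at hb3; omega
    · exact h
  -- missing edges
  have hbound : a * b ^ (q + 1) ≤ ∑ u ∈ A, dg G u Aᶜ ^ (q + 1) + 4 * (q + 1) * n ^ (q + 1) := by
    have := hmax (bip A) (bip_c5 A)
    rw [ep_bip, ← ha, ← hb] at this
    omega
  have hms : ∑ u ∈ A, dg G u Aᶜ ^ (q + 1) + b ^ q * ∑ u ∈ A, ms G u Aᶜ ≤ a * b ^ (q + 1) := by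
    rw [Finset.mul_sum, ← Finset.sum_add_distrib, ha, ← smul_eq_mul, ← Finset.sum_const]
    refine Finset.sum_le_sum fun u _ => ?_
    have e := dg_add_ms G u Aᶜ
    rw [← hb] at e
    have := pow_sub_bound (dg G u Aᶜ) (ms G u Aᶜ) q
    rw [e] at this
    rw [mul_comm (b ^ q)]
    exact this
  have hfin : b ^ q * ∑ u ∈ A, ms G u Aᶜ ≤
      b ^ q * (4 * (q + 1) * (4 * 3 ^ (q + 1)) ^ q * n) := by
    have hnq : n ^ q ≤ (4 * 3 ^ (q + 1) * b) ^ q := Nat.pow_le_pow_left hb3 _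
    calc b ^ q * ∑ u ∈ A, ms G u Aᶜ ≤ 4 * (q + 1) * n ^ (q + 1) := by omega
      _ = 4 * (q + 1) * n * n ^ q := by ring
      _ ≤ 4 * (q + 1) * n * (4 * 3 ^ (q + 1) * b) ^ q := by gcongr
      _ = _ := by rw [mul_pow (4 * 3 ^ (q + 1)) b]; ring
  exact Nat.le_of_mul_le_mul_left hfin (by positivity)

/-- robust common neighbourhoods -/
def Rob {V : Type*} (G : SimpleGraph V) (A B : Finset V) : Prop :=
  ∀ x ∈ A, ∀ x' ∈ A, ∀ F : Finset V, F.card ≤ 3 → ∃ y ∈ B, y ∉ F ∧ G.Adj x y ∧ G.Adj x' y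

theorem rob_indep {V : Type*} {G : SimpleGraph V} (hG : C5Free G) {A B : Finset V}
    (hd : Disjoint A B) (hA : Rob G A B) (hB : Rob G B A) {x y : V} (hx : x ∈ A) (hy : y ∈ A) :
    ¬ G.Adj x y := by
  classical
  intro h
  obtain ⟨b1, hb1, -, h1, -⟩ := hA x hx x hx ∅ (by simp)
  obtain ⟨b2, hb2, h2F, h2, -⟩ := hA y hy y hy {b1} (by simp)
  obtain ⟨a, ha, haF, h3, h4⟩ := hB b2 hb2 b1 hb1 {x, y}
    (by have := Finset.card_le_two (a := x) (b := y); omega)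
  simp only [Finset.mem_insert, Finset.mem_singleton, not_or] at h2F haF
  have hne : ∀ {u w : V}, u ∈ A → w ∈ B → u ≠ w := fun hu hw e =>
    Finset.disjoint_left.1 hd hu (e ▸ hw)
  exact c5_elim hG h h2 h3 h4.symm h1.symm (hne hx hb2) (Ne.symm haF.1) (Ne.symm haF.2)
    (hne hy hb1) h2F

theorem rob_side {V : Type*} {G : SimpleGraph V} (hG : C5Free G) {A B : Finset V}
    (hd : Disjoint A B) (hA : Rob G A B) (hB : Rob G B A) {w x y : V} (hx : x ∈ A) (hy : y ∈ B)
    (hwA : w ∉ A) (hwB : w ∉ B) (h1 : G.Adj w x) (h2 : G.Adj w y) : False := by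
  classical
  obtain ⟨a, ha, haF, h3, -⟩ := hB y hy y hy {x} (by simp)
  obtain ⟨b, hb, hbF, h4, h5⟩ := hA x hx a ha {y} (by simp)
  simp only [Finset.mem_singleton] at haF hbF
  have hne : ∀ {u w : V}, u ∈ A → w ∈ B → u ≠ w := fun hu hw e =>
    Finset.disjoint_left.1 hd hu (e ▸ hw)
  exact c5_elim hG h1 h4 h5.symm h3.symm h2.symm (fun e => hwB (e ▸ hb)) (fun e => hwA (e ▸ ha))
    (Ne.symm haF) (hne hx hy) hbF

theorem rob_edge {V : Type*} {G : SimpleGraph V} (hG : C5Free G) {A B : Finset V}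
    (hA : Rob G A B) {w w' x x' : V} (hx : x ∈ A) (hx' : x' ∈ A)
    (hwA : w ∉ A) (hwB : w ∉ B) (hwA' : w' ∉ A) (hwB' : w' ∉ B) (h : G.Adj w w')
    (h1 : G.Adj w x) (h2 : G.Adj w' x') : x = x' := by
  by_contra hne
  obtain ⟨b, hb, -, h3, h4⟩ := hA x hx x' hx' ∅ (by simp)
  exact c5_elim hG h1 h3 h4.symm h2.symm h.symm (fun e => hwB (e ▸ hb)) (fun e => hwA (e ▸ hx'))
    hne (fun e => hwA' (e ▸ hx)) (fun e => hwB' (e ▸ hb))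

theorem rob_low {V : Type*} [Fintype V] [DecidableEq V] {G : SimpleGraph V} (hG : C5Free G)
    {A B : Finset V} (hA : Rob G A B) {w w' : V}
    (hwA : w ∉ A) (hwB : w ∉ B) (hwA' : w' ∉ A) (hwB' : w' ∉ B) (h : G.Adj w w')
    (hw : ∀ y ∈ B, ¬ G.Adj w y) (hw' : ∀ y ∈ B, ¬ G.Adj w' y) {K : ℕ}
    (hK : (A ∪ B)ᶜ.card ≤ K) :
    dg G w Finset.univ ≤ K + 1 ∨ dg G w' Finset.univ ≤ K + 1 := by
  classical
  have main : ∀ u, (∀ y ∈ B, ¬ G.Adj u y) →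
      (∀ x ∈ A, ∀ x' ∈ A, G.Adj u x → G.Adj u x' → x = x') → dg G u Finset.univ ≤ K + 1 := by
    intro u hu hu2
    rw [dg_univ_split G u (A ∪ B)]
    have h1 : dg G u (A ∪ B)ᶜ ≤ K := (dg_le_card _ _ _).trans hK
    have h2 : dg G u (A ∪ B) ≤ 1 := by
      unfold dg
      rw [Finset.card_le_one]
      intro p hp q hq
      simp only [Finset.mem_filter, Finset.mem_union] at hp hq
      have hpA : p ∈ A := hp.1.resolve_right fun h => hu p h hp.2
      have hqA : q ∈ A := hq.1.resolve_right fun h => hu q h hq.2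
      exact hu2 p hpA q hqA hp.2 hq.2
    omega
  by_cases hex : ∃ x' ∈ A, G.Adj w' x'
  · obtain ⟨x', hx', hwx'⟩ := hex
    left
    refine main w hw fun p hp q hq h1 h2 => ?_
    rw [rob_edge hG hA hp hx' hwA hwB hwA' hwB' h h1 hwx',
      rob_edge hG hA hq hx' hwA hwB hwA' hwB' h h2 hwx']
  · push Not at hex
    right
    exact main w' hw' fun p hp q hq h1 h2 => absurd h1 (hex p hp)

theorem rob_struct {V : Type*} [Fintype V] [DecidableEq V] {G : SimpleGraph V} (hG : C5Free G)
    {A B : Finset V} (hd : Disjoint A B) (hA : Rob G A B) (hB : Rob G B A) {K : ℕ}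
    (hK : (A ∪ B)ᶜ.card ≤ K) :
    ∃ s : Finset V, A ⊆ s ∧ B ⊆ sᶜ ∧ ∀ w w', G.Adj w w' → (w ∈ s ↔ w' ∈ s) →
      w ∈ (A ∪ B)ᶜ ∧ w' ∈ (A ∪ B)ᶜ ∧
        (dg G w Finset.univ ≤ K + 1 ∨ dg G w' Finset.univ ≤ K + 1) := by
  classical
  have hBs : ∀ y ∈ B, ∃ x ∈ A, G.Adj y x := by
    intro y hy
    obtain ⟨x, hx, -, h, -⟩ := hB y hy y hy ∅ (by simp)
    exact ⟨x, hx, h⟩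
  refine ⟨Finset.univ.filter (fun w => ∀ x ∈ A, ¬ G.Adj w x), ?_, ?_, ?_⟩
  · intro x hx
    simp only [Finset.mem_filter, Finset.mem_univ, true_and]
    exact fun y hy => rob_indep hG hd hA hB hx hy
  · intro y hy
    simpa using hBs y hy
  · intro w w' h hs
    simp only [Finset.mem_filter, Finset.mem_univ, true_and] at hs
    by_cases hw : ∀ x ∈ A, ¬ G.Adj w x
    · have hw' := hs.1 hw
      have a1 : w ∉ A := fun hh => hw' w hh h.symm
      have a2 : w' ∉ A := fun hh => hw w' hh h
      have b1 : w ∉ B := fun hh => by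
        obtain ⟨x, hx, hx2⟩ := hBs w hh
        exact hw x hx hx2
      have b2 : w' ∉ B := fun hh => by
        obtain ⟨x, hx, hx2⟩ := hBs w' hh
        exact hw' x hx hx2
      refine ⟨by simp [a1, b1], by simp [a2, b2], ?_⟩
      exact rob_low hG hB b1 a1 b2 a2 h hw hw' (by rwa [Finset.union_comm])
    · have hw' := fun h => hw (hs.2 h)
      push Not at hw
      have hw' : ∃ x ∈ A, G.Adj w' x := by
        by_contra! hcon
        exact hw' hcon
      obtain ⟨x, hx, hwx⟩ := hw
      obtain ⟨x', hx', hwx'⟩ := hw'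
      have a1 : w ∉ A := fun hh => rob_indep hG hd hA hB hh hx hwx
      have a2 : w' ∉ A := fun hh => rob_indep hG hd hA hB hh hx' hwx'
      have b1 : w ∉ B := fun hh => by
        by_cases hh' : w' ∈ B
        · exact rob_indep hG hd.symm hB hA hh hh' h
        · exact rob_side hG hd hA hB hx' hh a2 hh' hwx' h.symm
      have b2 : w' ∉ B := fun hh => rob_side hG hd hA hB hx hh a1 b1 hwx h
      refine ⟨by simp [a1, b1], by simp [a2, b2], ?_⟩
      exact rob_low hG hA a1 b1 a2 b2 h
        (fun y hy hwy => rob_side hG hd hA hB hx hy a1 b1 hwx hwy)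
        (fun y hy hwy => rob_side hG hd hA hB hx' hy a2 b2 hwx' hwy) hK

theorem ms_symm {V : Type*} (G : SimpleGraph V) (A B : Finset V) :
    ∑ u ∈ A, ms G u B = ∑ u ∈ B, ms G u A := by
  classical
  unfold ms
  simp only [Finset.card_filter]
  rw [Finset.sum_comm]
  simp only [G.adj_comm]

theorem bad_count {V : Type*} (G : SimpleGraph V) {A B : Finset V} {C D n : ℕ}
    (hB : n ≤ D * B.card) (hB0 : 0 < B.card) (h : ∑ u ∈ A, ms G u B ≤ C * n) :
    (A.filter (fun u => B.card < 4 * ms G u B)).card ≤ 4 * C * D := by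
  have h1 : (A.filter (fun u => B.card < 4 * ms G u B)).card * B.card ≤ 4 * ∑ u ∈ A, ms G u B := by
    rw [Finset.mul_sum, ← smul_eq_mul, ← Finset.sum_const]
    calc _ ≤ ∑ u ∈ A.filter (fun u => B.card < 4 * ms G u B), 4 * ms G u B :=
          Finset.sum_le_sum fun u hu => (Finset.mem_filter.1 hu).2.le
      _ ≤ _ := Finset.sum_le_sum_of_subset (Finset.filter_subset _ _)
  refine Nat.le_of_mul_le_mul_right (c := B.card) ?_ hB0
  calc _ ≤ 4 * (C * n) := by omega
    _ ≤ 4 * (C * (D * B.card)) := by gcongr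
    _ = _ := by ring

theorem rob_of_bad {V : Type*} [DecidableEq V] (G : SimpleGraph V) {B A0 B0 : Finset V} {k : ℕ}
    (hA0 : ∀ x ∈ A0, 4 * ms G x B ≤ B.card)
    (hk : (B \ B0).card ≤ k) (hb : 2 * k + 6 < B.card) : Rob G A0 B0 := by
  classical
  intro x hx x' hx' F hF
  have h1 := hA0 x hx
  have h2 := hA0 x' hx'
  unfold ms at h1 h2
  set S1 := B.filter (fun w => ¬ G.Adj x w)
  set S2 := B.filter (fun w => ¬ G.Adj x' w)
  have hc : (S1 ∪ S2 ∪ (B \ B0) ∪ F).card < B.card := by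
    have e1 := Finset.card_union_le (S1 ∪ S2 ∪ (B \ B0)) F
    have e2 := Finset.card_union_le (S1 ∪ S2) (B \ B0)
    have e3 := Finset.card_union_le S1 S2
    omega
  obtain ⟨y, hy, hyF⟩ := Finset.exists_mem_notMem_of_card_lt_card hc
  simp only [S1, S2, Finset.mem_union, Finset.mem_filter, Finset.mem_sdiff, not_or, not_and,
    not_not] at hyF
  exact ⟨y, hyF.1.2 hy, hyF.2, hyF.1.1.1 hy, hyF.1.1.2 hy⟩

/-- the approximate structure of extremal graphs -/
theorem approx {q : ℕ} : ∃ D K N : ℕ, ∀ {V : Type} [Fintype V] [DecidableEq V]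
    {G : SimpleGraph V}, C5Free G →
    (∀ G' : SimpleGraph V, C5Free G' → ep G' (q + 1) ≤ ep G (q + 1)) →
    N ≤ Fintype.card V →
    ∃ s W : Finset V, W.card ≤ K ∧ Fintype.card V ≤ D * s.card + K * D ∧
      Fintype.card V ≤ D * sᶜ.card + K * D ∧
      ∀ w w', G.Adj w w' → (w ∈ s ↔ w' ∈ s) → w ∈ W ∧ w' ∈ W ∧
        (dg G w Finset.univ ≤ K + 1 ∨ dg G w' Finset.univ ≤ K + 1) := by
  classical
  set D := 4 * 3 ^ (q + 1) with hD
  set C := 4 * (q + 1) * (4 * 3 ^ (q + 1)) ^ q with hC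
  refine ⟨D, 8 * C * D, 3 ^ (q + 1) * (8 * (q + 1)) + D * (8 * C * D + 6) + 1, ?_⟩
  intro V _ _ G hG hmax hn
  obtain ⟨A, h1, h2, h3⟩ := stab hG hmax (by omega)
  rw [← hD] at h1 h2
  rw [← hC] at h3
  have ha : 8 * C * D + 6 < A.card := by
    by_contra! hh
    have := Nat.mul_le_mul_left D hh
    omega
  have hb : 8 * C * D + 6 < Aᶜ.card := by
    by_contra! hh
    have := Nat.mul_le_mul_left D hh
    omega
  have k1 := bad_count G h2 (by omega) h3
  rw [ms_symm] at h3
  have k2 := bad_count G h1 (by omega) h3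
  set A1 := A.filter (fun u => Aᶜ.card < 4 * ms G u Aᶜ) with hA1
  set B1 := Aᶜ.filter (fun u => A.card < 4 * ms G u A) with hB1
  have hA1s : A1 ⊆ A := Finset.filter_subset _ _
  have hB1s : B1 ⊆ Aᶜ := Finset.filter_subset _ _
  have hAe : A \ (A \ A1) = A1 := Finset.sdiff_sdiff_eq_self hA1s
  have hBe : Aᶜ \ (Aᶜ \ B1) = B1 := Finset.sdiff_sdiff_eq_self hB1s
  have kk : 4 * C * D + 4 * C * D = 8 * C * D := by ring
  have rA : Rob G (A \ A1) (Aᶜ \ B1) := by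
    refine rob_of_bad G (B := Aᶜ) (k := 4 * C * D) ?_ (by rwa [hBe]) (by omega)
    intro x hx
    simp only [hA1, Finset.mem_sdiff, Finset.mem_filter, not_and, not_lt] at hx
    exact hx.2 hx.1
  have rB : Rob G (Aᶜ \ B1) (A \ A1) := by
    refine rob_of_bad G (B := A) (k := 4 * C * D) ?_ (by rwa [hAe]) (by omega)
    intro x hx
    simp only [hB1, Finset.mem_sdiff, Finset.mem_filter, not_and, not_lt] at hx
    exact hx.2 hx.1
  have hd : Disjoint (A \ A1) (Aᶜ \ B1) :=
    Finset.disjoint_of_subset_left Finset.sdiff_subset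
      (Finset.disjoint_of_subset_right Finset.sdiff_subset disjoint_compl_right)
  have hW : ((A \ A1) ∪ (Aᶜ \ B1))ᶜ.card ≤ 8 * C * D := by
    have : ((A \ A1) ∪ (Aᶜ \ B1))ᶜ ⊆ A1 ∪ B1 := by
      intro x hx
      simp only [Finset.mem_compl, Finset.mem_union, Finset.mem_sdiff, not_or, not_and,
        not_not] at hx
      rw [Finset.mem_union]
      by_cases hxA : x ∈ A
      · exact Or.inl (hx.1 hxA)
      · exact Or.inr (hx.2 hxA)
    have := Finset.card_le_card this
    have := Finset.card_union_le A1 B1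
    omega
  obtain ⟨s, hs1, hs2, hs3⟩ := rob_struct hG hd rA rB hW
  refine ⟨s, _, hW, ?_, ?_, hs3⟩
  · have e1 := Finset.card_le_card hs1
    have e2 := Finset.card_sdiff_add_card_eq_card hA1s
    have e3 : A.card ≤ s.card + 8 * C * D := by omega
    have := Nat.mul_le_mul_left D e3
    rw [mul_add, mul_comm D (8 * C * D)] at this
    omega
  · have e1 := Finset.card_le_card hs2
    have e2 := Finset.card_sdiff_add_card_eq_card hB1s
    have e3 : Aᶜ.card ≤ sᶜ.card + 8 * C * D := by omega
    have := Nat.mul_le_mul_left D e3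
    rw [mul_add, mul_comm D (8 * C * D)] at this
    omega

/-- extremal graphs are complete bipartite -/
theorem exact_struct {q : ℕ} : ∃ N : ℕ, ∀ {V : Type} [Fintype V] [DecidableEq V]
    {G : SimpleGraph V}, C5Free G →
    (∀ G' : SimpleGraph V, C5Free G' → ep G' (q + 1) ≤ ep G (q + 1)) →
    N ≤ Fintype.card V → ∃ s : Finset V, G = bip s := by
  classical
  obtain ⟨D, K, N, h⟩ := approx (q := q)
  refine ⟨N + K + 2 * K * D + 1 +
    (2 * D) ^ (q + 1) * (K * ((q + 1) * K * 2 ^ q) + (K + 1) ^ (q + 1)), ?_⟩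
  intro V _ _ G hG hmax hn
  obtain ⟨s, W, hW, hs, hsc, hin⟩ := h hG hmax (by omega)
  set n := Fintype.card V with hndef
  set T := K * ((q + 1) * K * 2 ^ q) + (K + 1) ^ (q + 1) with hT
  refine ⟨s, ?_⟩
  have hHdeg : ∀ u, n ≤ 2 * D * dg (bip s) u Finset.univ := by
    intro u
    have e : 2 * K * D = K * D + K * D := by ring
    by_cases hu : u ∈ s
    · rw [dg_bip_mem s hu, mul_assoc]
      omega
    · rw [dg_bip_not_mem s hu, mul_assoc]
      omega
  have hHle : ∀ u, dg (bip s) u Finset.univ ≤ n := fun u => dg_le_card _ _ _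
  have hcmp : ∀ u, dg G u Finset.univ ≤ dg (bip s) u Finset.univ + (if u ∈ W then K else 0) := by
    intro u
    have hsub : Finset.univ.filter (fun w => G.Adj u w) ⊆
        Finset.univ.filter (fun w => (bip s).Adj u w) ∪
          Finset.univ.filter (fun w => u ∈ W ∧ w ∈ W) := by
      intro w hw
      simp only [Finset.mem_filter, Finset.mem_univ, true_and, Finset.mem_union] at hw ⊢
      by_cases hb : (bip s).Adj u w
      · exact Or.inl hb
      · right
        have : u ∈ s ↔ w ∈ s := by
          simp only [bip] at hb
          tauto
        have := hin u w hw this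
        exact ⟨this.1, this.2.1⟩
    have h1 := (Finset.card_le_card hsub).trans (Finset.card_union_le _ _)
    unfold dg
    refine h1.trans (Nat.add_le_add_left ?_ _)
    split_ifs with hu
    · refine le_trans (Finset.card_le_card ?_) hW
      intro w hw
      simp only [Finset.mem_filter] at hw
      exact hw.2.2
    · simp [hu]
  have hnoin : ∀ w w', G.Adj w w' → ¬ (w ∈ s ↔ w' ∈ s) := by
    intro w w' hadj hiff
    obtain ⟨hwW, hwW', hlow⟩ := hin w w' hadj hiff
    obtain ⟨l, hl⟩ : ∃ l, dg G l Finset.univ ≤ K + 1 := by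
      rcases hlow with h | h
      · exact ⟨_, h⟩
      · exact ⟨_, h⟩
    -- termwise bound
    have hterm : ∀ u, dg G u Finset.univ ^ (q + 1) ≤ dg (bip s) u Finset.univ ^ (q + 1) +
        (if u ∈ W then (q + 1) * K * (2 * n) ^ q else 0) := by
      intro u
      have hc := hcmp u
      split_ifs at hc ⊢ with hu
      · refine (Nat.pow_le_pow_left hc _).trans ((pow_add_bound _ _ _).trans ?_)
        have : dg (bip s) u Finset.univ + K ≤ 2 * n := by
          have := hHle u
          omega
        gcongr
      · exact Nat.pow_le_pow_left hc _
    have hsum : ep G (q + 1) + dg (bip s) l Finset.univ ^ (q + 1) ≤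
        ep (bip s) (q + 1) + K * ((q + 1) * K * (2 * n) ^ q) + (K + 1) ^ (q + 1) := by
      rw [ep_eq, ep_eq, ← Finset.add_sum_erase _ _ (Finset.mem_univ l),
        ← Finset.add_sum_erase (f := fun v => dg (bip s) v Finset.univ ^ (q + 1)) _
          (Finset.mem_univ l)]
      have h1 : ∑ u ∈ Finset.univ.erase l, dg G u Finset.univ ^ (q + 1) ≤
          ∑ u ∈ Finset.univ.erase l, dg (bip s) u Finset.univ ^ (q + 1) +
            K * ((q + 1) * K * (2 * n) ^ q) := by
        refine (Finset.sum_le_sum fun u _ => hterm u).trans ?_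
        rw [Finset.sum_add_distrib]
        refine Nat.add_le_add_left ?_ _
        refine (Finset.sum_le_sum_of_subset (Finset.subset_univ _)).trans ?_
        rw [← Finset.sum_filter, Finset.sum_const, smul_eq_mul]
        refine Nat.mul_le_mul_right _ ?_
        simpa using hW
      have h2 := Nat.pow_le_pow_left hl (q + 1)
      omega
    have hm := hmax (bip s) (bip_c5 s)
    have hle : dg (bip s) l Finset.univ ^ (q + 1) ≤ T * n ^ q := by
      have hn1 : 1 ≤ n ^ q := Nat.one_le_pow _ _ (by omega)
      have : (K + 1) ^ (q + 1) ≤ (K + 1) ^ (q + 1) * n ^ q := Nat.le_mul_of_pos_right _ hn1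
      have e : T * n ^ q = K * ((q + 1) * K * (2 * n) ^ q) + (K + 1) ^ (q + 1) * n ^ q := by
        rw [hT, mul_pow]; ring
      omega
    have h3 : n * n ^ q ≤ ((2 * D) ^ (q + 1) * T) * n ^ q := by
      calc n * n ^ q = n ^ (q + 1) := by ring
        _ ≤ (2 * D * dg (bip s) l Finset.univ) ^ (q + 1) := Nat.pow_le_pow_left (hHdeg l) _
        _ = (2 * D) ^ (q + 1) * dg (bip s) l Finset.univ ^ (q + 1) := by rw [mul_pow]
        _ ≤ (2 * D) ^ (q + 1) * (T * n ^ q) := by gcongr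
        _ = _ := by ring
    have h4 := Nat.le_of_mul_le_mul_right h3 (Nat.pow_pos (by omega))
    omega
  have hsubG : ∀ a b, G.Adj a b → (bip s).Adj a b := by
    intro a b hab
    have := hnoin a b hab
    simp only [bip]
    tauto
  by_contra hne
  have : ∃ a b, (bip s).Adj a b ∧ ¬ G.Adj a b := by
    by_contra! hcon
    apply hne
    ext a b
    exact ⟨hsubG a b, hcon a b⟩
  obtain ⟨a, b, hab, hab'⟩ := this
  have hlt : ep G (q + 1) < ep (bip s) (q + 1) := by
    rw [ep_eq, ep_eq]
    refine Finset.sum_lt_sum (fun u _ => Nat.pow_le_pow_left ?_ _) ⟨a, Finset.mem_univ _, ?_⟩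
    · unfold dg
      refine Finset.card_le_card fun w hw => ?_
      simp only [Finset.mem_filter, Finset.mem_univ, true_and] at hw ⊢
      exact hsubG _ _ hw
    · refine Nat.pow_lt_pow_left ?_ (by omega)
      unfold dg
      refine Finset.card_lt_card ⟨fun w hw => ?_, fun hh => ?_⟩
      · simp only [Finset.mem_filter, Finset.mem_univ, true_and] at hw ⊢
        exact hsubG _ _ hw
      · have hb : b ∈ Finset.univ.filter (fun w => (bip s).Adj a w) := by simpa using hab
        have := hh hb
        simp only [Finset.mem_filter, Finset.mem_univ, true_and] at this
        exact hab' this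
  have := hmax (bip s) (bip_c5 s)
  omega

/-- the limiting density function -/
def ff (p : ℕ) (x : ℝ) : ℝ := x * (1 - x) ^ p + x ^ p * (1 - x)

theorem ff_symm (p : ℕ) (x : ℝ) : ff p (1 - x) = ff p x := by
  unfold ff; ring

theorem ff_cont (p : ℕ) : Continuous (ff p) := by
  unfold ff; fun_prop

/-- numerator of the derivative in terms of the ratio -/
def gg (q : ℕ) (r : ℝ) : ℝ := 1 - (q + 1) * r + (q + 1) * r ^ q - r ^ (q + 1)

theorem ff_deriv (q : ℕ) (x : ℝ) : HasDerivAt (ff (q + 1))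
    ((1 - x) ^ (q + 1) - (q + 1) * x * (1 - x) ^ q + (q + 1) * x ^ q * (1 - x) - x ^ (q + 1)) x := by
  have h1 : HasDerivAt (fun x : ℝ => 1 - x) (-1) x := by
    simpa using (hasDerivAt_id x).const_sub 1
  have h2 := ((hasDerivAt_id x).mul (h1.pow (q + 1))).add (((hasDerivAt_id x).pow (q + 1)).mul h1)
  refine HasDerivAt.congr_deriv (f := ff (q + 1)) h2 ?_
  simp
  ring

theorem gg_of_crit {q : ℕ} {x : ℝ} (hx : x < 1) (h : (1 - x) ^ (q + 1) -
    (q + 1) * x * (1 - x) ^ q + (q + 1) * x ^ q * (1 - x) - x ^ (q + 1) = 0) :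
    gg q (x / (1 - x)) = 0 := by
  have h1 : 0 < 1 - x := by linarith
  have h2 : (1 - x) ^ (q + 1) * gg q (x / (1 - x)) = 0 := by
    rw [← h]
    unfold gg
    rw [div_pow, div_pow]
    field_simp
    ring
  rcases mul_eq_zero.1 h2 with h3 | h3
  · exact absurd h3 (by positivity)
  · exact h3

theorem gg_inv {q : ℕ} {r : ℝ} (hr : 0 < r) (h : gg q r = 0) : gg q r⁻¹ = 0 := by
  have h2 : r ^ (q + 1) * gg q r⁻¹ = - gg q r := by
    unfold gg
    rw [inv_pow, inv_pow]
    field_simp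
    ring
  rw [h, neg_zero] at h2
  rcases mul_eq_zero.1 h2 with h3 | h3
  · exact absurd h3 (by positivity)
  · exact h3

theorem gg_roots {q : ℕ} {r t : ℝ} (h1 : 1 < r) (h2 : r < t) (hr : gg q r = 0)
    (ht : gg q t = 0) : False := by
  rcases q with _ | _ | k
  · simp [gg] at hr
    linarith
  · simp [gg] at hr
    nlinarith
  · have hone : gg (k + 1 + 1) 1 = 0 := by
      simp [gg]
      ring
    have hinv : gg (k + 1 + 1) t⁻¹ = 0 := gg_inv (by linarith) ht
    have hti : t⁻¹ < 1 := inv_lt_one_of_one_lt₀ (by linarith)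
    have htp : 0 < t⁻¹ := inv_pos.2 (by linarith)
    set g1 : ℝ → ℝ := fun x => -((k : ℝ) + 3) + (k + 3) * (k + 2) * x ^ (k + 1) -
      (k + 3) * x ^ (k + 2) with hg1
    set g2 : ℝ → ℝ := fun x => ((k : ℝ) + 3) * (k + 2) * (k + 1) * x ^ k -
      (k + 3) * (k + 2) * x ^ (k + 1) with hg2
    have d1 : ∀ x, HasDerivAt (gg (k + 1 + 1)) (g1 x) x := by
      intro x
      have := ((((hasDerivAt_const x (1 : ℝ)).sub ((hasDerivAt_id x).const_mul ((k : ℝ) + 3))).add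
        ((hasDerivAt_pow (k + 2) x).const_mul ((k : ℝ) + 3))).sub (hasDerivAt_pow (k + 3) x))
      have e : gg (k + 1 + 1) = fun y => 1 - ((k : ℝ) + 3) * y + ((k : ℝ) + 3) * y ^ (k + 2) -
          y ^ (k + 3) := by
        ext y
        simp only [gg]
        push_cast
        ring
      rw [e]
      refine HasDerivAt.congr_deriv this ?_
      simp only [hg1, Nat.add_sub_cancel, Nat.add_succ_sub_one]
      push_cast
      ring
    have d2 : ∀ x, HasDerivAt g1 (g2 x) x := by
      intro x
      have := (((hasDerivAt_const x (-((k : ℝ) + 3))).add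
        ((hasDerivAt_pow (k + 1) x).const_mul (((k : ℝ) + 3) * (k + 2)))).sub
          ((hasDerivAt_pow (k + 2) x).const_mul ((k : ℝ) + 3)))
      refine HasDerivAt.congr_deriv this ?_
      simp only [hg2, Nat.add_sub_cancel, Nat.add_succ_sub_one]
      push_cast
      ring
    have c1 : Continuous (gg (k + 1 + 1)) := continuous_iff_continuousAt.2 fun x =>
      (d1 x).continuousAt
    have c2 : Continuous g1 := continuous_iff_continuousAt.2 fun x => (d2 x).continuousAt
    obtain ⟨u1, hu1, e1⟩ := exists_hasDerivAt_eq_zero hti c1.continuousOn (hinv.trans hone.symm)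
      (fun x _ => d1 x)
    obtain ⟨u2, hu2, e2⟩ := exists_hasDerivAt_eq_zero h1 c1.continuousOn (hone.trans hr.symm)
      (fun x _ => d1 x)
    obtain ⟨u3, hu3, e3⟩ := exists_hasDerivAt_eq_zero h2 c1.continuousOn (hr.trans ht.symm)
      (fun x _ => d1 x)
    obtain ⟨w1, hw1, i1⟩ := exists_hasDerivAt_eq_zero (hu1.2.trans hu2.1) c2.continuousOn
      (e1.trans e2.symm) (fun x _ => d2 x)
    obtain ⟨w2, hw2, i2⟩ := exists_hasDerivAt_eq_zero (hu2.2.trans hu3.1) c2.continuousOn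
      (e2.trans e3.symm) (fun x _ => d2 x)
    have key : ∀ w, 0 < w → g2 w = 0 → w = k + 1 := by
      intro w hw hz
      have : (((k : ℝ) + 3) * (k + 2) * w ^ k) * (k + 1 - w) = 0 := by
        rw [← hz, hg2]; ring
      rcases mul_eq_zero.1 this with h | h
      · exact absurd h (by positivity)
      · linarith
    have a1 := key w1 (by linarith [hw1.1, hu1.1]) i1
    have a2 := key w2 (by linarith [hw2.1, hu2.1]) i2
    linarith [hw1.2, hw2.1]

theorem ff_uniq_lt {q : ℕ} {x y : ℝ} (hx : 1 / 2 ≤ x) (hxy : x < y) (hy : y ≤ 1)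
    (he : ff (q + 1) x = ff (q + 1) y)
    (hmax : ∀ z ∈ Set.Icc (0 : ℝ) 1, ff (q + 1) z ≤ ff (q + 1) y) : False := by
  have hy1 : y < 1 := by
    refine lt_of_le_of_ne hy fun e => ?_
    have := hmax (1 / 2) (by norm_num)
    rw [e] at this
    have h0 : ff (q + 1) 1 = 0 := by simp [ff]
    have h1 : 0 < ff (q + 1) (1 / 2) := by
      unfold ff
      norm_num
      positivity
    linarith
  obtain ⟨z, hz, ez⟩ := exists_hasDerivAt_eq_zero hxy (ff_cont (q + 1)).continuousOn he
    (fun x _ => ff_deriv q x)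
  have ey : (1 - y) ^ (q + 1) - (q + 1) * y * (1 - y) ^ q + (q + 1) * y ^ q * (1 - y) -
      y ^ (q + 1) = 0 := by
    refine IsLocalMax.hasDerivAt_eq_zero ?_ (ff_deriv q y)
    filter_upwards [Icc_mem_nhds (show (0 : ℝ) < y by linarith) hy1] with w hw
    exact hmax w hw
  have g1 := gg_of_crit (hz.2.trans hy1) ez
  have g2 := gg_of_crit hy1 ey
  refine gg_roots ?_ ?_ g1 g2
  · rw [lt_div_iff₀ (by linarith [hz.2])]
    linarith [hz.1]
  · rw [div_lt_div_iff₀ (by linarith [hz.2]) (by linarith)]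
    nlinarith [hz.2]

theorem ff_stab {q : ℕ} {c : ℝ} (hc : c ∈ Set.Icc (1 / 2 : ℝ) 1)
    (hmax : ∀ z ∈ Set.Icc (0 : ℝ) 1, ff (q + 1) z ≤ ff (q + 1) c) {ε : ℝ} (hε : 0 < ε) :
    ∃ δ > 0, ∀ x ∈ Set.Icc (1 / 2 : ℝ) 1, ff (q + 1) c - δ < ff (q + 1) x → |x - c| ≤ ε := by
  set S : Set ℝ := Set.Icc (1 / 2 : ℝ) 1 ∩ {x | ε ≤ |x - c|} with hS
  have hSc : IsCompact S := isCompact_Icc.inter_right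
    (isClosed_le continuous_const (by fun_prop))
  rcases S.eq_empty_or_nonempty with he | hne
  · refine ⟨1, one_pos, fun x hx _ => ?_⟩
    by_contra! hcon
    have : x ∈ S := ⟨hx, hcon.le⟩
    simp [he] at this
  · obtain ⟨x0, hx0, hx0m⟩ := hSc.exists_isMaxOn hne (ff_cont (q + 1)).continuousOn
    have hlt : ff (q + 1) x0 < ff (q + 1) c := by
      refine lt_of_le_of_ne (hmax x0 ⟨by linarith [hx0.1.1], hx0.1.2⟩) fun e => ?_
      have hd : ε ≤ |x0 - c| := hx0.2
      rcases lt_trichotomy x0 c with h | h | h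
      · exact ff_uniq_lt hx0.1.1 h hc.2 e hmax
      · rw [h, sub_self, abs_zero] at hd
        linarith
      · exact ff_uniq_lt hc.1 h hx0.1.2 e.symm (fun z hz => e ▸ hmax z hz)
    refine ⟨ff (q + 1) c - ff (q + 1) x0, by linarith, fun x hx hxx => ?_⟩
    by_contra! hcon
    have := hx0m (show x ∈ S from ⟨hx, hcon.le⟩)
    change ff (q + 1) x ≤ ff (q + 1) x0 at this
    linarith

theorem ff_exists (p : ℕ) : ∃ c ∈ Set.Icc (1 / 2 : ℝ) 1,
    ∀ z ∈ Set.Icc (0 : ℝ) 1, ff p z ≤ ff p c := by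
  obtain ⟨c, hc, hm⟩ := (isCompact_Icc (a := (1 / 2 : ℝ)) (b := 1)).exists_isMaxOn
    ⟨1, by norm_num⟩ (ff_cont p).continuousOn
  refine ⟨c, hc, fun z hz => ?_⟩
  rcases le_total (1 / 2) z with h | h
  · exact hm ⟨h, hz.2⟩
  · rw [← ff_symm]
    exact hm (show 1 - z ∈ Set.Icc (1 / 2 : ℝ) 1 from ⟨by linarith, by linarith [hz.1]⟩)

theorem ep_bip_ff {n : ℕ} (hn : 0 < n) (s : Finset (Fin n)) (p : ℕ) :
    (ep (bip s) p : ℝ) = (n : ℝ) ^ (p + 1) * ff p ((s.card : ℝ) / n) := by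
  have h : ((sᶜ.card : ℕ) : ℝ) = n - s.card := by
    have := Finset.card_add_card_compl s
    rw [Fintype.card_fin] at this
    rw [eq_sub_iff_add_eq]
    exact_mod_cast (by omega : sᶜ.card + s.card = n)
  have hn' : (0 : ℝ) < n := by exact_mod_cast hn
  rw [ep_bip]
  push_cast
  rw [h]
  have e : 1 - (s.card : ℝ) / n = (n - s.card) / n := by field_simp
  unfold ff
  rw [e, div_pow, div_pow]
  field_simp
  ring

theorem bip_compl {V : Type*} [Fintype V] [DecidableEq V] (s : Finset V) : bip sᶜ = bip s := by
  ext a b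
  simp only [bip, Finset.mem_compl]
  tauto

theorem stmt0 (p : ℕ) (hp : 1 ≤ p) :
    ∃ c : ℝ, c ∈ Set.Icc (1/2 : ℝ) 1 ∧
      (∀ x ∈ Set.Icc (0:ℝ) 1,
        x * (1 - x) ^ p + x ^ p * (1 - x) ≤ c * (1 - c) ^ p + c ^ p * (1 - c)) ∧
      ∀ ε : ℝ, 0 < ε → ∃ N : ℕ, ∀ n : ℕ, N ≤ n →
        ∀ G : SimpleGraph (Fin n), C5Free G →
          (∀ G' : SimpleGraph (Fin n), C5Free G' → ep G' p ≤ ep G p) →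
          ∃ (m : ℕ) (s : Finset (Fin n)), s.card = m ∧
            (∀ a b, G.Adj a b ↔ ((a ∈ s ∧ b ∉ s) ∨ (a ∉ s ∧ b ∈ s))) ∧
            |(m : ℝ) - c * n| ≤ ε * n := by
  obtain ⟨q, rfl⟩ : ∃ q, p = q + 1 := ⟨p - 1, by omega⟩
  obtain ⟨c, hc, hmaxc⟩ := ff_exists (q + 1)
  refine ⟨c, hc, hmaxc, ?_⟩
  intro ε hε
  obtain ⟨δ, hδ, hst⟩ := ff_stab hc hmaxc hε
  obtain ⟨N1, hN1⟩ := exact_struct (q := q)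
  have htend : Filter.Tendsto (fun n : ℕ => ff (q + 1) ((⌊c * (n : ℝ)⌋₊ : ℝ) / n)) Filter.atTop
      (nhds (ff (q + 1) c)) := by
    have h1 := (tendsto_nat_floor_mul_div_atTop (R := ℝ) (a := c) (by linarith [hc.1])).comp
      tendsto_natCast_atTop_atTop
    exact ((ff_cont (q + 1)).tendsto c).comp h1
  obtain ⟨N2, hN2⟩ := Filter.eventually_atTop.1
    (htend.eventually (lt_mem_nhds (show ff (q + 1) c - δ < ff (q + 1) c by linarith)))
  refine ⟨N1 + N2 + 1, fun n hn G hG hmax => ?_⟩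
  have hn0 : 0 < n := by omega
  have hn' : (0 : ℝ) < n := by exact_mod_cast hn0
  obtain ⟨s0, hs0⟩ := hN1 hG hmax (by rw [Fintype.card_fin]; omega)
  obtain ⟨s, hs, hsn⟩ : ∃ s : Finset (Fin n), G = bip s ∧ n ≤ 2 * s.card := by
    have := Finset.card_add_card_compl s0
    rw [Fintype.card_fin] at this
    by_cases h : n ≤ 2 * s0.card
    · exact ⟨s0, hs0, h⟩
    · exact ⟨s0ᶜ, by rw [bip_compl, hs0], by omega⟩
  refine ⟨s.card, s, rfl, fun a b => by rw [hs]; rfl, ?_⟩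
  have hle : ⌊c * (n : ℝ)⌋₊ ≤ n := by
    apply Nat.floor_le_of_le
    nlinarith [hc.2]
  obtain ⟨t, -, ht⟩ := Finset.exists_subset_card_eq (s := (Finset.univ : Finset (Fin n)))
    (n := ⌊c * (n : ℝ)⌋₊) (by simpa using hle)
  have h1 : (ep (bip t) (q + 1) : ℝ) ≤ ep G (q + 1) := by exact_mod_cast hmax (bip t) (bip_c5 t)
  rw [hs, ep_bip_ff hn0, ep_bip_ff hn0, ht] at h1
  have h2 := le_of_mul_le_mul_left h1 (by positivity)
  have h3 := hN2 n (by omega)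
  have hsc : s.card ≤ n := by simpa using Finset.card_le_univ s
  have hsc' : (s.card : ℝ) ≤ n := by exact_mod_cast hsc
  have hsn' : (n : ℝ) ≤ 2 * s.card := by exact_mod_cast hsn
  have h4 := hst ((s.card : ℝ) / n) ⟨by rw [le_div_iff₀ hn']; linarith, by
    rw [div_le_one hn']; exact hsc'⟩ (lt_of_lt_of_le h3 h2)
  have h5 : (s.card : ℝ) - c * n = ((s.card : ℝ) / n - c) * n := by field_simp
  rw [h5, abs_mul, abs_of_pos hn']
  gcongr
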